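/- Every closed k-cluster B of the sequence of active regions {A_q}, with k finite, contains a minimal closed k-cluster subset; moreover the intersection of any chain (ordered by inclusion) of closed k-clusters is again a k-cluster. -/

import Mathlib

open MeasureTheory Filter Set
open scoped ENNReal

noncomputable section

/-- Points of the spatial domain. -/
abbrev Vec3 := Fin 3 → ℝ

/-- The compact space-time domain `Ω_T = [0,T] × [0,L]³`. -/
def ΩTc (T L : ℝ) : Set (ℝ × Vec3) :=
  Set.Icc (0:ℝ) T ×ˢ Set.Icc (0 : Vec3) (fun _ => L)

/-- The maximal gap beyond `Q`:
`sup {q₂ - q₁ : q₁, q₂ > Q, (⋃_{q₁ ≤ q ≤ q₂} A_q) ∩ U = ∅}` (in `ℕ∞`; `sup ∅ = 0`). -/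
def gapFn (A : ℕ → Set (ℝ × Vec3)) (U : Set (ℝ × Vec3)) (Q : ℕ) : ℕ∞ :=
  sSup ((fun p : ℕ × ℕ => ((p.2 - p.1 : ℕ) : ℕ∞)) ''
    {p : ℕ × ℕ | Q < p.1 ∧ p.1 ≤ p.2 ∧ ∀ q, p.1 ≤ q → q ≤ p.2 → A q ∩ U = ∅})

/-- `B` is a `k`-cluster of `{A_q}` if for every open `U ⊇ B` the limit as `Q → ∞` of the
maximal `U`-avoiding gap beyond `Q` equals `k`. -/
def IsKCluster (A : ℕ → Set (ℝ × Vec3)) (B : Set (ℝ × Vec3)) (k : ℕ) : Prop :=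
  ∀ U : Set (ℝ × Vec3), IsOpen U → B ⊆ U →
    Filter.Tendsto (fun Q => gapFn A U Q) Filter.atTop (nhds (k : ℕ∞))

/-- A closed `k`-cluster `B` is minimal if every proper closed subset has a strictly
larger cluster index. -/
def IsMinimalKCluster (A : ℕ → Set (ℝ × Vec3)) (B : Set (ℝ × Vec3)) (k : ℕ) : Prop :=
  IsClosed B ∧ IsKCluster A B k ∧
    ∀ B' : Set (ℝ × Vec3), IsClosed B' → B' ⊆ B → B' ≠ B →
      ∀ j : ℕ, IsKCluster A B' j → k < j

theorem isCompact_ΩTc (T L : ℝ) : IsCompact (ΩTc T L) :=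
  isCompact_Icc.prod isCompact_Icc

theorem exists_mem_subset_of_isChain {X : Type*} [TopologicalSpace X] {C : Set (Set X)}
    (hne : C.Nonempty) (hC : IsChain (· ⊆ ·) C) (hcpt : ∀ B ∈ C, IsCompact B)
    (hcl : ∀ B ∈ C, IsClosed B) {U : Set X} (hU : IsOpen U) (h : ⋂₀ C ⊆ U) :
    ∃ B ∈ C, B ⊆ U := by
  have : Nonempty C := hne.to_subtype
  obtain ⟨⟨B, hB⟩, hBU⟩ := exists_subset_nhds_of_isCompact' (V := fun B : C => (B : Set X))
    (fun B D => (hC.total B.2 D.2).elim (fun h => ⟨B, Subset.rfl, h⟩) fun h => ⟨D, h, Subset.rfl⟩)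
    (fun B => hcpt B B.2) (fun B => hcl B B.2) (U := U)
    (fun x hx => hU.mem_nhds (h (by rwa [sInter_eq_iInter])))
  exact ⟨B, hB, hBU⟩

theorem isKCluster_sInter {A : ℕ → Set (ℝ × Vec3)} {k : ℕ} {C : Set (Set (ℝ × Vec3))}
    (hne : C.Nonempty) (hC : IsChain (· ⊆ ·) C) (hcpt : ∀ B ∈ C, IsCompact B)
    (hk : ∀ B ∈ C, IsKCluster A B k) : IsKCluster A (⋂₀ C) k := by
  intro U hU hCU
  obtain ⟨B, hB, hBU⟩ := exists_mem_subset_of_isChain hne hC hcpt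
    (fun B hB => (hcpt B hB).isClosed) hU hCU
  exact hk B hB U hU hBU

/-- The index of a cluster is the limiting gap for the whole space, hence is determined by `A`. -/
theorem IsKCluster.index_eq {A : ℕ → Set (ℝ × Vec3)} {B B' : Set (ℝ × Vec3)} {k j : ℕ}
    (hB : IsKCluster A B k) (hB' : IsKCluster A B' j) : k = j := by
  exact_mod_cast tendsto_nhds_unique (hB univ isOpen_univ (subset_univ B))
    (hB' univ isOpen_univ (subset_univ B'))

theorem exists_isMinimalKCluster_subset {A : ℕ → Set (ℝ × Vec3)} {k : ℕ} {B : Set (ℝ × Vec3)}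
    (hB : IsCompact B) (hk : IsKCluster A B k) : ∃ B₀ ⊆ B, IsMinimalKCluster A B₀ k := by
  obtain ⟨B₀, hB₀, hmin⟩ := zorn_superset_nonempty
    {D | D ⊆ B ∧ IsClosed D ∧ IsKCluster A D k}
    (fun c hc hchain hne => ⟨⋂₀ c,
      ⟨(sInter_subset_of_mem hne.some_mem).trans (hc hne.some_mem).1,
        isClosed_sInter fun D hD => (hc hD).2.1,
        isKCluster_sInter hne hchain
          (fun D hD => hB.of_isClosed_subset (hc hD).2.1 (hc hD).1)
          (fun D hD => (hc hD).2.2)⟩,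
      fun D hD => sInter_subset_of_mem hD⟩)
    B ⟨Subset.rfl, hB.isClosed, hk⟩
  refine ⟨B₀, hB₀, hmin.prop.2.1, hmin.prop.2.2, fun B' hcl hsub hneq j hj => ?_⟩
  obtain rfl := hmin.prop.2.2.index_eq hj
  exact absurd (hsub.antisymm (hmin.le_of_le ⟨hsub.trans hB₀, hcl, hj⟩ hsub)) hneq

/-- Every closed `k`-cluster (`k` finite) of the active regions contains
a minimal closed `k`-cluster subset; and the intersection of any chain of closed
`k`-clusters is again a `k`-cluster. -/
theorem statement16 (T L : ℝ) (hT : 0 < T) (hL : 0 < L)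
    (A : ℕ → Set (ℝ × Vec3)) (hA : ∀ q, A q ⊆ ΩTc T L) (k : ℕ) :
    (∀ B : Set (ℝ × Vec3), IsClosed B → B ⊆ ΩTc T L → IsKCluster A B k →
      ∃ B₀ : Set (ℝ × Vec3), B₀ ⊆ B ∧ IsMinimalKCluster A B₀ k) ∧
    (∀ C : Set (Set (ℝ × Vec3)), C.Nonempty → IsChain (· ⊆ ·) C →
      (∀ B ∈ C, B ⊆ ΩTc T L ∧ IsClosed B ∧ IsKCluster A B k) →
      IsKCluster A (⋂₀ C) k) := by
  refine ⟨fun B hcl hsub hk => ?_, fun C hne hC h => ?_⟩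
  · exact exists_isMinimalKCluster_subset ((isCompact_ΩTc T L).of_isClosed_subset hcl hsub) hk
  · exact isKCluster_sInter hne hC
      (fun B hB => (isCompact_ΩTc T L).of_isClosed_subset (h B hB).2.1 (h B hB).1)
      (fun B hB => (h B hB).2.2)
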